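/- arXiv:math/0601479 — 3 statements merged into one kernel-verified Lean document; each statement's English description precedes it below -/
import Mathlib

section
/- Let $q$ be a prime power. For every integer $N \geq 0$, $T^{q^{N+1}} - T$ equals the product of all monic polynomials in $\mathbb{F}_q[T]$ of degree $N+1$, divided by the $q$-th power of the product of all monic polynomials in $\mathbb{F}_q[T]$ of degree $N$. -/
open scoped BigOperators

namespace MonicProduct

open Polynomial Finset

variable (F : Type*) [Field F] [Fintype F]

lemma finite_monic_natDegree_eq (N : ℕ) :
    {f : F[X] | f.Monic ∧ f.natDegree = N}.Finite :=
  Set.finite_coe_iff.mp <| Finite.of_equiv (Fin N → F)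
    ((monicEquivDegreeLT N).trans (degreeLTEquiv F N).toEquiv).symm

lemma card_monic_natDegree_eq (N : ℕ) :
    #(finite_monic_natDegree_eq F N).toFinset = Fintype.card F ^ N := by
  rw [← Set.ncard_eq_toFinset_card _ (finite_monic_natDegree_eq F N), ← Nat.card_coe_set_eq,
    Nat.card_congr (α := {f : F[X] | f.Monic ∧ f.natDegree = N})
      ((monicEquivDegreeLT N).trans (degreeLTEquiv F N).toEquiv)]
  simp

variable {F}

lemma pow_card_pow_eq_aeval {K : Type*} [Field K] [Algebra F[X] K] [Algebra F K]
    [IsScalarTower F F[X] K] (f : F[X]) (j : ℕ) :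
    algebraMap F[X] K f ^ Fintype.card F ^ j =
      (f.map (algebraMap F K)).eval (algebraMap F[X] K X ^ Fintype.card F ^ j) := by
  have h : f ^ Fintype.card F ^ j = aeval (X ^ Fintype.card F ^ j : F[X]) f := by
    induction j with
    | zero => simp
    | succ j ih =>
      rw [pow_succ, pow_mul, ih, pow_mul, ← map_pow, ← FiniteField.expand_card,
        ← FiniteField.expand_card (X ^ _), expand_aeval]
      simp [← pow_mul, mul_comm]
  rw [← map_pow, h, eval_map_algebraMap, ← map_pow, aeval_algebraMap_apply]

lemma injective_X_pow_card_pow :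
    Function.Injective fun j : ℕ => (X ^ Fintype.card F ^ j : F[X]) := fun i j h => by
  have := congrArg natDegree h
  simpa using Nat.pow_right_injective Fintype.one_lt_card (by simpa using this)

/-- The product of all monic polynomials of degree `N` is the product of the
`X ^ q ^ N - X ^ q ^ i` over `i < N`. -/
lemma prod_monic_natDegree_eq (N : ℕ) :
    ∏ f ∈ (finite_monic_natDegree_eq F N).toFinset, f =
      ∏ i ∈ range N, ((X : F[X]) ^ Fintype.card F ^ N - X ^ Fintype.card F ^ i) := by
  set q := Fintype.card F
  have q1 : 1 < q := Fintype.one_lt_card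
  set S := (finite_monic_natDegree_eq F N).toFinset with hS
  have hcard : #S = q ^ N := card_monic_natDegree_eq F N
  let K := RatFunc F
  let φ := algebraMap F[X] K
  have hφ : Function.Injective φ := IsFractionRing.injective F[X] K
  let v : ℕ → K := fun j => φ (X ^ q ^ j)
  have hv : Function.Injective v := hφ.comp injective_X_pow_card_pow
  let w : ℕ → K := fun i => (∏ j ∈ (range (N + 1)).erase i, (v i - v j))⁻¹
  -- The divided difference of a monic polynomial of degree `N` at the `N + 1` nodes is `1`.
  have key : ∀ f ∈ S, ∑ i ∈ range (N + 1), w i * φ f ^ q ^ i = 1 := by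
    intro f hf
    obtain ⟨hm, hd⟩ : f.Monic ∧ f.natDegree = N := by simpa [hS] using hf
    have h := Lagrange.coeff_eq_sum (s := range (N + 1)) (v := v) hv.injOn
      (P := f.map (algebraMap F K)) (by
        rw [degree_map, card_range, degree_eq_natDegree hm.ne_zero, hd]
        exact_mod_cast Nat.lt_succ_self N)
    rw [card_range, Nat.add_sub_cancel, coeff_map, ← hd, hm.coeff_natDegree, map_one, hd] at h
    rw [h]
    refine sum_congr rfl fun i _ => ?_
    rw [pow_card_pow_eq_aeval f i, div_eq_inv_mul, ← map_pow]
  let Q : K[X] := ∏ f ∈ S, (X - C (φ f))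
  have hQm : Q.Monic := monic_prod_of_monic _ _ fun f _ => monic_X_sub_C _
  have hQd : Q.degree = (q ^ N : ℕ) := by
    simp [Q, degree_prod, hcard]
  let P : K[X] := ∑ i ∈ range N, C (w i) * X ^ q ^ i + (C (w N) * (X ^ q ^ N - Q) - 1)
  have hP : P = 0 := by
    refine eq_zero_of_degree_lt_of_eval_index_eq_zero (s := S) (v := φ) hφ.injOn ?_ ?_
    · rw [hcard]
      simp only [P, ← mem_degreeLT]
      refine add_mem (sum_mem fun i hi => ?_) (sub_mem ?_ ?_)
      · rw [mem_degreeLT]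
        refine (degree_C_mul_X_pow_le _ _).trans_lt ?_
        exact_mod_cast Nat.pow_lt_pow_right q1 (mem_range.mp hi)
      · rw [← smul_eq_C_mul]
        refine Submodule.smul_mem _ _ ?_
        rw [mem_degreeLT]
        have := degree_sub_lt_left (p := (X ^ q ^ N : K[X])) (q := Q) (by rw [hQd, degree_X_pow])
          (monic_X_pow _).ne_zero (by rw [hQm.leadingCoeff, (monic_X_pow _).leadingCoeff])
        simpa using this
      · rw [mem_degreeLT, degree_one]
        exact_mod_cast pow_pos (zero_lt_one.trans q1) N
    · intro f hf
      have hQ : Q.eval (φ f) = 0 := by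
        rw [eval_prod]
        exact prod_eq_zero hf (by simp)
      have := key f hf
      rw [sum_range_succ] at this
      simp only [P, eval_add, eval_sub, eval_mul, eval_finsetSum, eval_C, eval_pow, eval_X, hQ,
        eval_one]
      linear_combination this
  have h0 := congrArg (eval 0) hP
  have hneg : (-1 : K) ^ q ^ N = -1 := by
    have := congrArg (algebraMap F K) (FiniteField.pow_card_pow N (-1 : F))
    simpa using this
  have hq0 : ∀ n, q ^ n ≠ 0 := fun n => (pow_pos (zero_lt_one.trans q1) n).ne'
  have hQ0 : Q.eval 0 = -φ (∏ f ∈ S, f) := by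
    simp only [Q, eval_prod, eval_sub, eval_X, eval_C, zero_sub, prod_neg, hcard, hneg, map_prod]
    ring
  have hw : w N * φ (∏ f ∈ S, f) = 1 := by
    simp only [P, eval_add, eval_sub, eval_mul, eval_finsetSum, eval_C, eval_pow, eval_X, hQ0,
      eval_one, eval_zero, zero_pow (hq0 _), mul_zero, sum_const_zero] at h0
    linear_combination h0
  apply hφ
  have hwN : w N = (φ (∏ i ∈ range N, (X ^ q ^ N - X ^ q ^ i)))⁻¹ := by
    simp only [w, v, range_add_one, erase_insert notMem_range_self, map_prod, map_sub]
  rw [hwN] at hw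
  have hne := left_ne_zero_of_mul_eq_one hw
  rwa [inv_mul_eq_one₀ (fun h => hne (by rw [h, inv_zero])), eq_comm] at hw

end MonicProduct

/-- In `𝔽_q[T]`, writing `D_N` for the product of all monic polynomials of degree
exactly `N`, we have `T^{q^{N+1}} - T = D_{N+1} / D_N^q`, i.e.
`D_{N+1} = (T^{q^{N+1}} - T) · D_N^q`. -/
theorem stmt12 (𝔽 : Type*) [Field 𝔽] [Fintype 𝔽] (q : ℕ) (hq : q = Fintype.card 𝔽)
    (N : ℕ) :
    (∏ᶠ f ∈ {f : Polynomial 𝔽 | f.Monic ∧ f.natDegree = N + 1}, f) =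
      ((Polynomial.X : Polynomial 𝔽) ^ q ^ (N + 1) - Polynomial.X) *
        (∏ᶠ f ∈ {f : Polynomial 𝔽 | f.Monic ∧ f.natDegree = N}, f) ^ q := by
  subst hq
  rw [finprod_mem_eq_finite_toFinset_prod _ (MonicProduct.finite_monic_natDegree_eq 𝔽 (N + 1)),
    finprod_mem_eq_finite_toFinset_prod _ (MonicProduct.finite_monic_natDegree_eq 𝔽 N),
    MonicProduct.prod_monic_natDegree_eq, MonicProduct.prod_monic_natDegree_eq,
    Finset.prod_range_succ', pow_zero, pow_one, mul_comm, ← Finset.prod_pow]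
  congr 1
  refine Finset.prod_congr rfl fun i _ => ?_
  rw [← FiniteField.expand_card]
  simp [pow_succ', pow_mul]
end

section
/- Let $k = \mathbb{F}_q((\pi))$, $\mathcal{O} = \mathbb{F}_q[[\pi]]$, $L = \pi^{-1}\mathbb{F}_q[\pi^{-1}]$, and write $x = \lfloor x\rfloor + \langle x\rangle$ with $\lfloor x\rfloor \in L$, $\langle x\rangle \in \mathcal{O}$. Fix $t \in k$ and $a \in k^\times$. Then $(t + L) \cap a(t + \mathcal{O}) \neq \emptyset$ if and only if $\langle (a-1)t \rangle \in a\mathcal{O}$, and in that case $\lfloor at \rfloor + \langle t \rangle \in (t+L) \cap a(t+\mathcal{O})$. -/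
/-- The principal parts and the integral parts intersect trivially. -/
theorem LaurentSeries.eq_zero_of_mem_span_of_mem_range {𝔽 : Type*} [Field 𝔽]
    {x : LaurentSeries 𝔽}
    (hL : x ∈ Submodule.span 𝔽 {x : LaurentSeries 𝔽 |
      ∃ i : ℕ, 1 ≤ i ∧ x = (HahnSeries.single (1 : ℤ) (1 : 𝔽)) ^ (-(i : ℤ))})
    (hO : x ∈ (HahnSeries.ofPowerSeries ℤ 𝔽).range) : x = 0 := by
  have hnonneg : ∀ n : ℤ, 0 ≤ n → x.coeff n = 0 := by
    intro n hn
    clear hO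
    induction hL using Submodule.span_induction with
    | mem y hy =>
      obtain ⟨i, hi, rfl⟩ := hy
      simp only [zpow_neg, zpow_natCast, HahnSeries.single_pow, HahnSeries.inv_single,
        one_pow, inv_one]
      exact HahnSeries.coeff_single_of_ne (by rw [nsmul_one]; omega)
    | zero => simp
    | add y z _ _ hy hz => simp_all
    | smul c y _ hy => simp_all
  ext n
  rcases le_or_gt 0 n with hn | hn
  · simpa using hnonneg n hn
  · obtain ⟨f, rfl⟩ := hO
    rw [HahnSeries.ofPowerSeries_apply, HahnSeries.embDomain_of_notMem_range]
    · simp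
    · rintro ⟨m, rfl⟩
      simp at hn
      omega

/-- A Laurent series or its inverse is a power series. -/
theorem LaurentSeries.mem_range_or_inv_mem_range {𝔽 : Type*} [Field 𝔽] (a : LaurentSeries 𝔽) :
    a ∈ (HahnSeries.ofPowerSeries ℤ 𝔽).range ∨ a⁻¹ ∈ (HahnSeries.ofPowerSeries ℤ 𝔽).range :=
  ValuationRing.isInteger_or_isInteger (PowerSeries 𝔽) a

/-- In `k = 𝔽_q((π))` with `𝒪 = 𝔽_q[[π]]`, `L = π⁻¹𝔽_q[π⁻¹]`, and the projections
`⌊·⌋ : k → L`, `⟨·⟩ : k → 𝒪` of the decomposition `k = L ⊕ 𝒪`: for `t ∈ k` and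
`a ∈ k^×`, the set `(t + L) ∩ a(t + 𝒪)` is nonempty if and only if
`⟨(a-1)t⟩ ∈ a𝒪`, in which case `⌊at⌋ + ⟨t⟩` belongs to it. -/
theorem stmt17 (𝔽 : Type*) [Field 𝔽] [Fintype 𝔽]
    (π : LaurentSeries 𝔽) (hπ : π = HahnSeries.single (1 : ℤ) (1 : 𝔽))
    (L : Submodule 𝔽 (LaurentSeries 𝔽))
    (hL : L = Submodule.span 𝔽 {x : LaurentSeries 𝔽 | ∃ i : ℕ, 1 ≤ i ∧ x = π ^ (-(i : ℤ))})
    (O : Set (LaurentSeries 𝔽))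
    (hO : O = Set.range (HahnSeries.ofPowerSeries ℤ 𝔽))
    (fl intPart : LaurentSeries 𝔽 → LaurentSeries 𝔽)
    (hdec : ∀ x : LaurentSeries 𝔽, fl x ∈ L ∧ intPart x ∈ O ∧ x = fl x + intPart x)
    (t a : LaurentSeries 𝔽) (ha : a ≠ 0) :
    (({x | ∃ l ∈ L, x = t + l} ∩ {x | ∃ u ∈ O, x = a * (t + u)} :
        Set (LaurentSeries 𝔽)).Nonempty ↔
      intPart ((a - 1) * t) ∈ {x : LaurentSeries 𝔽 | ∃ u ∈ O, x = a * u}) ∧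
    (intPart ((a - 1) * t) ∈ {x : LaurentSeries 𝔽 | ∃ u ∈ O, x = a * u} →
      fl (a * t) + intPart t ∈
        ({x | ∃ l ∈ L, x = t + l} ∩ {x | ∃ u ∈ O, x = a * (t + u)} :
          Set (LaurentSeries 𝔽))) := by
  subst hπ hL
  set R := (HahnSeries.ofPowerSeries ℤ 𝔽).range with hR
  replace hO : ∀ x, x ∈ O ↔ x ∈ R := fun x => by rw [hO, hR]; rfl
  simp only [hO, Set.mem_ofPred_eq] at hdec ⊢
  have uniq : ∀ x l u, l ∈ Submodule.span 𝔽 {x : LaurentSeries 𝔽 |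
      ∃ i : ℕ, 1 ≤ i ∧ x = (HahnSeries.single (1 : ℤ) (1 : 𝔽)) ^ (-(i : ℤ))} → u ∈ R →
      x = l + u → intPart x = u := by
    intro x l u hl hu hx
    obtain ⟨h1, h2, h3⟩ := hdec x
    refine sub_eq_zero.mp (LaurentSeries.eq_zero_of_mem_span_of_mem_range ?_ (R.sub_mem h2 hu))
    have : intPart x - u = l - fl x := by linear_combination hx - h3
    rw [this]
    exact Submodule.sub_mem _ hl h1
  have key : (∃ u ∈ R, intPart ((a - 1) * t) = a * u) →
      fl (a * t) + intPart t ∈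
        ({x | ∃ l ∈ Submodule.span 𝔽 {x : LaurentSeries 𝔽 |
          ∃ i : ℕ, 1 ≤ i ∧ x = (HahnSeries.single (1 : ℤ) (1 : 𝔽)) ^ (-(i : ℤ))}, x = t + l} ∩
          {x | ∃ u ∈ R, x = a * (t + u)} : Set (LaurentSeries 𝔽)) := by
    rintro ⟨u, hu, h⟩
    obtain ⟨h1, h2, h3⟩ := hdec t
    obtain ⟨k1, k2, k3⟩ := hdec (a * t)
    have e := uniq ((a - 1) * t) (fl (a * t) - fl t) (intPart (a * t) - intPart t)
      (Submodule.sub_mem _ k1 h1) (R.sub_mem k2 h2) (by linear_combination k3 - h3)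
    exact ⟨⟨fl (a * t) - fl t, Submodule.sub_mem _ k1 h1, by linear_combination -h3⟩,
      -u, R.neg_mem hu, by linear_combination e - h - k3⟩
  refine ⟨⟨?_, fun h => ⟨_, key h⟩⟩, key⟩
  rintro ⟨x, ⟨l, hl, rfl⟩, u, hu, hx⟩
  rcases LaurentSeries.mem_range_or_inv_mem_range a with h | h
  · exact ⟨-u, R.neg_mem hu, uniq _ l _ hl (R.mul_mem h (R.neg_mem hu))
      (by linear_combination -hx)⟩
  · exact ⟨a⁻¹ * intPart ((a - 1) * t), R.mul_mem h (hdec _).2.1, by field_simp⟩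
end

section
/- Let $k$ be a local field of characteristic $p>0$ with absolute value $\|\cdot\|$, let $L \subset k$ be a discrete cocompact subgroup and $U \subset k$ an open compact subset. For $n \in \mathbb{Z}$ define $L_n = (\pi^{-n}\mathcal{O} \cap L) \oplus \bigoplus_{i=n+1}^{\infty}\mathbb{F}_q\pi^{-i}$, where $\pi$ is a fixed uniformizer and $k \cong \mathbb{F}_q((\pi))$. Define the dual lattice $M^\perp = \{\xi \in k \mid \mathrm{Res}(x\xi\,\omega) = 0 \text{ for all } x \in M\}$ with respect to a fixed nonzero Chevalley differential $\omega$. Then $\#(L^\perp \cap U) = \#(L_n^\perp \cap U)$ for all sufficiently large $n$. -/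
namespace LaurentSeries

open Topology

variable {K : Type*} [Field K]

/-- The fractional ideal `X ^ D • K⟦X⟧`: the Laurent series whose coefficients vanish below `D`. -/
def coeffBall (K : Type*) [Field K] (D : ℤ) : AddSubgroup (LaurentSeries K) where
  carrier := {x | ∀ i < D, x.coeff i = 0}
  zero_mem' := by simp
  add_mem' := fun ha hb i hi => by simp [ha i hi, hb i hi]
  neg_mem' := fun ha i hi => by simp [ha i hi]

theorem mem_coeffBall {D : ℤ} {x : LaurentSeries K} :
    x ∈ coeffBall K D ↔ ∀ i < D, x.coeff i = 0 := Iff.rfl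

theorem coeffBall_anti {D E : ℤ} (h : D ≤ E) : coeffBall K E ≤ coeffBall K D :=
  fun _ hx i hi => hx i (hi.trans_le h)

theorem exists_mem_coeffBall (x : LaurentSeries K) : ∃ D : ℤ, x ∈ coeffBall K D :=
  ⟨x.order, fun _ hi => HahnSeries.coeff_eq_zero_of_lt_order hi⟩

theorem mul_mem_coeffBall {D E : ℤ} {x y : LaurentSeries K} (hx : x ∈ coeffBall K D)
    (hy : y ∈ coeffBall K E) : x * y ∈ coeffBall K (D + E) := by
  intro i hi
  rw [HahnSeries.coeff_mul]
  refine Finset.sum_eq_zero fun ij hij => ?_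
  rw [Finset.mem_antidiagonal] at hij
  by_cases h : ij.1 < D
  · rw [hx _ h, zero_mul]
  · rw [hy _ (by omega), mul_zero]

theorem map_mulLeft_range_ofPowerSeries (n : ℤ) :
    AddSubgroup.map (AddMonoidHom.mulLeft (HahnSeries.single n (1 : K) : LaurentSeries K))
      ((HahnSeries.ofPowerSeries ℤ K).range.toAddSubgroup) = coeffBall K n := by
  ext x
  constructor
  · rintro ⟨_, ⟨f, rfl⟩, rfl⟩ i hi
    rw [AddMonoidHom.coe_mulLeft, HahnSeries.coeff_single_mul, PowerSeries.coeff_coe,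
      if_pos (by omega), mul_zero]
  · intro hx
    have hx' : (HahnSeries.single (-n) (1 : K) : LaurentSeries K) * x ∈ coeffBall K 0 := by
      intro i hi
      rw [HahnSeries.coeff_single_mul, hx _ (by omega), mul_zero]
    obtain ⟨f, hf⟩ := (val_le_one_iff_eq_coe K (HahnSeries.single (-n) (1 : K) * x)).1
      ((valuation_le_iff_coeff_lt_eq_zero K (D := 0)).2 hx')
    refine ⟨_, ⟨f, hf⟩, ?_⟩
    rw [AddMonoidHom.coe_mulLeft, ← mul_assoc, HahnSeries.single_mul_single, add_neg_cancel,
      one_mul, HahnSeries.single_zero_one, one_mul]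

theorem coeffBall_mem_nhds_zero (D : ℤ) : (coeffBall K D : Set (LaurentSeries K)) ∈ 𝓝 0 := by
  have h : (coeffBall K D : Set (LaurentSeries K)) =
      {x | Valued.v x ≤ WithZero.exp (-D)} := by
    ext x
    exact (valuation_le_iff_coeff_lt_eq_zero K).symm
  obtain ⟨y, hy⟩ := valuation_surjective K (WithZero.exp (-D))
  rw [h, ← hy]
  simp_rw [← Valued.v.restrict_le_iff]
  refine (Valued.isOpen_closedBall _ ?_).mem_nhds (by simp)
  rw [Valuation.ne_zero_iff, ← Valuation.ne_zero_iff Valued.v, hy]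
  exact WithZero.exp_ne_zero

theorem exists_coeffBall_subset {s : Set (LaurentSeries K)} (hs : s ∈ 𝓝 0) :
    ∃ D : ℤ, (coeffBall K D : Set (LaurentSeries K)) ⊆ s := by
  obtain ⟨γ, hγ⟩ := Valued.mem_nhds_zero.1 hs
  obtain ⟨m, hm⟩ : ∃ m : ℤ, MonoidWithZeroHom.ValueGroup₀.embedding γ.1 = WithZero.exp m :=
    ⟨_, (WithZero.exp_log (by simp)).symm⟩
  refine ⟨1 - m, fun x hx => hγ ?_⟩
  have h := (valuation_le_iff_coeff_lt_eq_zero K).2 hx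
  rw [Set.mem_ofPred_eq, Valuation.restrict_lt_iff_lt_embedding, hm]
  exact h.trans_lt (WithZero.exp_lt_exp.2 (by omega))

theorem isOpen_coeffBall (D : ℤ) : IsOpen (coeffBall K D : Set (LaurentSeries K)) :=
  AddSubgroup.isOpen_of_mem_nhds _ (coeffBall_mem_nhds_zero D)

/-- A linear functional that kills a neighbourhood of zero and every monomial vanishes. -/
theorem linearMap_eq_zero {φ : LaurentSeries K →ₗ[K] K} {m : ℤ}
    (hm : ∀ x ∈ coeffBall K m, φ x = 0)
    (hX : ∀ i : ℤ, φ (HahnSeries.single i 1) = 0) : φ = 0 := by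
  have key : ∀ k : ℕ, ∀ x ∈ coeffBall K (m - k), φ x = 0 := by
    intro k
    induction k with
    | zero => simpa using hm
    | succ k ih =>
      intro x hx
      set i : ℤ := m - (k + 1 : ℕ)
      have h : x - x.coeff i • HahnSeries.single i (1 : K) ∈ coeffBall K (m - k) := by
        intro j hj
        rcases eq_or_ne j i with rfl | hji
        · simp
        · rw [HahnSeries.coeff_sub, HahnSeries.coeff_smul, HahnSeries.coeff_single_of_ne hji,
            hx j (by omega)]
          simp
      have := ih _ h
      rwa [map_sub, map_smul, hX, smul_zero, sub_zero] at this
  ext x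
  obtain ⟨D, hD⟩ := exists_mem_coeffBall x
  exact key (m - D).toNat x (coeffBall_anti (by omega) hD)

/-- Every locally constant linear functional is of the form `x ↦ (x * c).coeff 0`. -/
theorem exists_eq_coeff_mul {ω : LaurentSeries K →ₗ[K] K}
    (hω : IsLocallyConstant (ω : LaurentSeries K → K)) :
    ∃ c : LaurentSeries K, ∀ x, ω x = (x * c).coeff 0 := by
  obtain ⟨m, hm⟩ := exists_coeffBall_subset ((hω.isOpen_fiber 0).mem_nhds (map_zero ω))
  have hbdd : ∀ i < 1 - m, ω (HahnSeries.single (-i) 1) = 0 := fun i hi =>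
    hm fun j hj => HahnSeries.coeff_single_of_ne (by omega)
  obtain ⟨c, hc⟩ : ∃ c : LaurentSeries K, ∀ i, c.coeff i = ω (HahnSeries.single (-i) 1) :=
    ⟨HahnSeries.ofSuppBddBelow _
      ⟨1 - m, fun i hi => not_lt.1 fun h => hi (hbdd i h)⟩, fun _ => rfl⟩
  have hcb : c ∈ coeffBall K (1 - m) := fun i hi => (hc i).trans (hbdd i hi)
  let ψ : LaurentSeries K →ₗ[K] K :=
    { toFun := fun x => (x * c).coeff 0
      map_add' := fun x y => by simp [add_mul]
      map_smul' := fun a x => by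
        rw [← HahnSeries.single_zero_mul_eq_smul, mul_assoc, HahnSeries.single_zero_mul_eq_smul]
        simp }
  have h0 : ω - ψ = 0 := by
    refine linearMap_eq_zero (m := m) (fun x hx => ?_) fun i => ?_
    · have h1 : ω x = 0 := hm hx
      have h2 : ψ x = 0 := mul_mem_coeffBall hx hcb 0 (by omega)
      simp [h1, h2]
    · have h2 : ψ (HahnSeries.single i 1) = ω (HahnSeries.single i 1) := by
        change (HahnSeries.single i 1 * c).coeff 0 = _
        simp [HahnSeries.coeff_single_mul, hc]
      simp [h2]
  exact ⟨c, fun x => LinearMap.congr_fun (sub_eq_zero.1 h0) x⟩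

/-- A cocompact subgroup together with some fractional ideal generates the whole field. -/
theorem exists_sub_mem_coeffBall (L : AddSubgroup (LaurentSeries K))
    [CompactSpace (LaurentSeries K ⧸ L)] :
    ∃ D : ℤ, ∀ x, ∃ l ∈ L, x - l ∈ coeffBall K D := by
  obtain ⟨D, hD⟩ := isCompact_univ.elim_directed_cover
    (fun D : ℤ => ((↑) : LaurentSeries K → LaurentSeries K ⧸ L) '' (coeffBall K D))
    (fun D => QuotientAddGroup.isOpenMap_coe _ (isOpen_coeffBall D))
    (fun q _ => by
      obtain ⟨x, rfl⟩ := QuotientAddGroup.mk_surjective q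
      obtain ⟨D, hD⟩ := exists_mem_coeffBall x
      exact Set.mem_iUnion.2 ⟨D, x, hD, rfl⟩)
    (fun D E => ⟨min D E, Set.image_mono (coeffBall_anti (min_le_left _ _)),
      Set.image_mono (coeffBall_anti (min_le_right _ _))⟩)
  refine ⟨D, fun x => ?_⟩
  obtain ⟨y, hy, hyx⟩ := hD (Set.mem_univ (x : LaurentSeries K ⧸ L))
  refine ⟨x - y, ?_, by simpa using hy⟩
  rw [sub_eq_neg_add]
  exact QuotientAddGroup.eq.1 hyx

variable {ω : LaurentSeries K →ₗ[K] K} {c : LaurentSeries K}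

theorem apply_single_mul (hc : ∀ x, ω x = (x * c).coeff 0) (i : ℤ) (ξ : LaurentSeries K) :
    ω (HahnSeries.single (-i) 1 * ξ) = (c * ξ).coeff i := by
  rw [hc, mul_assoc, HahnSeries.coeff_single_mul, mul_comm ξ c]
  simp

/-- The annihilator of `coeffBall K (-n)` with respect to the residue pairing. -/
theorem mul_mem_coeffBall_iff (hc : ∀ x, ω x = (x * c).coeff 0) {n : ℤ} {ξ : LaurentSeries K} :
    c * ξ ∈ coeffBall K (n + 1) ↔ ∀ x ∈ coeffBall K (-n), ω (x * ξ) = 0 := by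
  refine ⟨fun h x hx => ?_, fun h i hi => ?_⟩
  · rw [hc, mul_assoc, mul_comm ξ c]
    exact mul_mem_coeffBall hx h 0 (by omega)
  · rw [← apply_single_mul hc]
    exact h _ fun j hj => HahnSeries.coeff_single_of_ne (by omega)

/-- Removing the coefficients of `c * ξ` above `n` by a correction of `ξ`. -/
theorem exists_truncation (hc0 : c ≠ 0) (n : ℤ) (ξ : LaurentSeries K) :
    ∃ y, c * (y - ξ) ∈ coeffBall K (n + 1) ∧ ∀ i, n < i → (c * y).coeff i = 0 := by
  refine ⟨c⁻¹ * HahnSeries.truncLT (n + 1) (c * ξ), ?_, fun i hi => ?_⟩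
  · rw [mul_sub, mul_inv_cancel_left₀ hc0]
    intro i hi
    rw [HahnSeries.coeff_sub, HahnSeries.coeff_truncLT_of_lt hi, sub_self]
  · rw [mul_inv_cancel_left₀ hc0, HahnSeries.coeff_truncLT_of_le (by omega)]

/-- A compact open set is stable under translation by a small enough ball. -/
theorem exists_forall_add_mem (hc0 : c ≠ 0) {U : Set (LaurentSeries K)} (hUo : IsOpen U)
    (hUc : IsCompact U) :
    ∃ N : ℤ, ∀ u ∈ U, ∀ v, c * v ∈ coeffBall K (N + 1) → u + v ∈ U := by
  obtain ⟨V, hV, hUV⟩ := compact_open_separated_add_right hUc hUo subset_rfl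
  obtain ⟨E, hE⟩ := exists_coeffBall_subset hV
  obtain ⟨d, hd⟩ := exists_mem_coeffBall c⁻¹
  refine ⟨E - d, fun u hu v hv => hUV (Set.add_mem_add hu (hE ?_))⟩
  rw [← inv_mul_cancel_left₀ hc0 v]
  exact coeffBall_anti (by omega) (mul_mem_coeffBall hd hv)

theorem isClosed_forall_apply_mul_eq_zero (hω : IsLocallyConstant (ω : LaurentSeries K → K))
    (S : Set (LaurentSeries K)) : IsClosed {ξ | ∀ x ∈ S, ω (x * ξ) = 0} := by
  have h : {ξ | ∀ x ∈ S, ω (x * ξ) = 0} = ⋂ x ∈ S, (fun ξ => x * ξ) ⁻¹' {y | ω y = 0} := by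
    ext; simp
  rw [h]
  exact isClosed_biInter fun x _ => (hω.isClosed_fiber 0).preimage (continuous_const_mul x)

/-- Elements of a compact set that annihilate a large enough part of `L` are close to elements
of the set that annihilate all of `L`. -/
theorem exists_close_annihilator (hω : IsLocallyConstant (ω : LaurentSeries K → K))
    (c : LaurentSeries K) (L : AddSubgroup (LaurentSeries K)) {U : Set (LaurentSeries K)}
    (hUc : IsCompact U) (E : ℤ) :
    ∃ M : ℤ, ∀ ξ ∈ U, (∀ x ∈ L ⊓ coeffBall K (-M), ω (x * ξ) = 0) →
      ∃ η ∈ U, (∀ x ∈ L, ω (x * η) = 0) ∧ c * (ξ - η) ∈ coeffBall K E := by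
  let far : Set (LaurentSeries K) :=
    {ξ | ∀ η ∈ U, (∀ x ∈ L, ω (x * η) = 0) → c * (ξ - η) ∉ coeffBall K E}
  have hfar : IsClosed far := by
    have h : far = ⋂ η ∈ U, ⋂ _ : ∀ x ∈ L, ω (x * η) = 0,
        (fun ξ => c * (ξ - η)) ⁻¹' (coeffBall K E : Set (LaurentSeries K))ᶜ := by
      ext; simp [far]
    rw [h]
    exact isClosed_biInter fun η _ => isClosed_iInter fun _ =>
      (isOpen_coeffBall E).isClosed_compl.preimage (by fun_prop)
  obtain ⟨M, hM⟩ := hUc.elim_directed_family_closed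
    (fun M : ℤ => {ξ | ∀ x ∈ L ⊓ coeffBall K (-M), ω (x * ξ) = 0} ∩ far)
    (fun M => (isClosed_forall_apply_mul_eq_zero hω _).inter hfar)
    (by
      refine Set.eq_empty_of_forall_notMem fun ξ ⟨hξU, hξ⟩ => ?_
      rw [Set.mem_iInter] at hξ
      refine (hξ 0).2 ξ hξU (fun x hx => ?_) (by simp)
      obtain ⟨D, hD⟩ := exists_mem_coeffBall x
      exact (hξ (-D)).1 x ⟨hx, by rwa [neg_neg]⟩)
    (directed_of_isDirected_le fun M M' h ξ hξ =>
      ⟨fun x hx => hξ.1 x ⟨hx.1, coeffBall_anti (by omega) hx.2⟩, hξ.2⟩)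
  refine ⟨M, fun ξ hξU hξ => ?_⟩
  by_contra! h
  exact hM.subset ⟨hξU, hξ, h⟩

/-- The annihilator of the modification of `L` by the standard lattice outside
`coeffBall K (-n)`. -/
theorem annihilator_modified_lattice_iff (hc : ∀ x, ω x = (x * c).coeff 0)
    (L : AddSubgroup (LaurentSeries K)) (n : ℤ) (ξ : LaurentSeries K) :
    (∀ x ∈ (L ⊓ coeffBall K (-n)) ⊔ (Submodule.span K
        {x : LaurentSeries K | ∃ i : ℤ, n < i ∧ x = HahnSeries.single (-i) 1}).toAddSubgroup,
      ω (x * ξ) = 0) ↔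
    (∀ x ∈ L ⊓ coeffBall K (-n), ω (x * ξ) = 0) ∧ ∀ i, n < i → (c * ξ).coeff i = 0 := by
  constructor
  · refine fun h => ⟨fun x hx => h x (AddSubgroup.mem_sup_left hx), fun i hi => ?_⟩
    rw [← apply_single_mul hc]
    exact h _ (AddSubgroup.mem_sup_right (Submodule.subset_span ⟨i, hi, rfl⟩))
  · rintro ⟨h₁, h₂⟩ x hx
    obtain ⟨y, hy, z, hz, rfl⟩ := AddSubgroup.mem_sup.1 hx
    rw [add_mul, map_add, h₁ y hy, zero_add]
    clear hx
    change z ∈ Submodule.span K _ at hz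
    induction hz using Submodule.span_induction with
    | mem z hz =>
      obtain ⟨i, hi, rfl⟩ := hz
      rw [apply_single_mul hc, h₂ i hi]
    | zero => simp
    | add u v _ _ hu hv =>
      rw [add_mul, map_add, hu, hv, add_zero]
    | smul a u _ hu =>
      rw [← HahnSeries.single_zero_mul_eq_smul, mul_assoc, HahnSeries.single_zero_mul_eq_smul,
        map_smul, hu, smul_zero]

end LaurentSeries


/-- Dual-lattice point counts: in `k = 𝔽_q((π))` with its valuation topology, let `ω` be a
nonzero Chevalley differential (a nonzero locally constant `𝔽_q`-linear functional
`k → 𝔽_q`), `L ⊆ k` a discrete cocompact additive subgroup, and `U ⊆ k` open and compact.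
For `n ∈ ℤ` let `Lₙ = (π^{-n}𝒪 ∩ L) ⊕ ⊕_{i>n} 𝔽_q·π^{-i}` and let
`M^⊥ = {ξ | ω(xξ) = 0 for all x ∈ M}` denote the dual lattice.  Then
`#(L^⊥ ∩ U) = #(Lₙ^⊥ ∩ U)` for all sufficiently large `n`. -/
theorem stmt19 (𝔽 : Type*) [Field 𝔽] [Fintype 𝔽]
    (π : LaurentSeries 𝔽) (hπ : π = HahnSeries.single (1 : ℤ) (1 : 𝔽))
    (ω : LaurentSeries 𝔽 →ₗ[𝔽] 𝔽)
    (hωlc : IsLocallyConstant (ω : LaurentSeries 𝔽 → 𝔽)) (hω0 : ω ≠ 0)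
    (L : AddSubgroup (LaurentSeries 𝔽)) [DiscreteTopology L]
    [CompactSpace (LaurentSeries 𝔽 ⧸ L)]
    (U : Set (LaurentSeries 𝔽)) (hUo : IsOpen U) (hUc : IsCompact U)
    (perp : AddSubgroup (LaurentSeries 𝔽) → Set (LaurentSeries 𝔽))
    (hperp : ∀ M : AddSubgroup (LaurentSeries 𝔽),
      perp M = {ξ : LaurentSeries 𝔽 | ∀ x ∈ M, ω (x * ξ) = 0})
    (Ln : ℤ → AddSubgroup (LaurentSeries 𝔽))
    (hLn : ∀ n : ℤ, Ln n =
      (L ⊓ AddSubgroup.map (AddMonoidHom.mulLeft (π ^ (-n)))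
          ((HahnSeries.ofPowerSeries ℤ 𝔽).range.toAddSubgroup)) ⊔
        (Submodule.span 𝔽
          {x : LaurentSeries 𝔽 | ∃ i : ℤ, n < i ∧ x = π ^ (-i)}).toAddSubgroup) :
    ∃ N : ℤ, ∀ n : ℤ, N ≤ n →
      Nat.card ↥(perp L ∩ U) = Nat.card ↥(perp (Ln n) ∩ U) := by
  subst hπ
  obtain ⟨c, hc⟩ := LaurentSeries.exists_eq_coeff_mul hωlc
  have hc0 : c ≠ 0 := by
    rintro rfl
    exact hω0 (LinearMap.ext fun x => by simp [hc])
  have hL : ∀ ξ, ξ ∈ perp L ↔ ∀ x ∈ L, ω (x * ξ) = 0 := fun ξ => by rw [hperp]; rfl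
  have hLn' : ∀ n ξ, ξ ∈ perp (Ln n) ↔
      (∀ x ∈ L ⊓ LaurentSeries.coeffBall 𝔽 (-n), ω (x * ξ) = 0) ∧
        ∀ i, n < i → (c * ξ).coeff i = 0 := fun n ξ => by
    rw [hperp, hLn, ← LaurentSeries.annihilator_modified_lattice_iff hc,
      ← LaurentSeries.map_mulLeft_range_ofPowerSeries]
    simp only [← RatFunc.single_zpow]
    rfl
  obtain ⟨N₁, hN₁⟩ := LaurentSeries.exists_forall_add_mem hc0 hUo hUc
  obtain ⟨D, hD⟩ := LaurentSeries.exists_sub_mem_coeffBall L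
  obtain ⟨M, hM⟩ :=
    LaurentSeries.exists_close_annihilator hωlc c L hUc (max N₁ (-D) + 1)
  refine ⟨max M (max N₁ (-D)), fun n hn => ?_⟩
  simp only [max_le_iff] at hn
  obtain ⟨hnM, hnN, hnD⟩ := hn
  choose T hT hT' using LaurentSeries.exists_truncation hc0 n
  have hTU : ∀ ξ ∈ U, T ξ ∈ U := fun ξ hξ => by
    rw [← add_sub_cancel ξ (T ξ)]
    exact hN₁ ξ hξ _ (LaurentSeries.coeffBall_anti (by omega) (hT ξ))
  have hTL : ∀ ξ, (∀ x ∈ L, ω (x * ξ) = 0) → ∀ x ∈ L ⊓ LaurentSeries.coeffBall 𝔽 (-n),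
      ω (x * T ξ) = 0 := fun ξ hξ x hx => by
    have h := (LaurentSeries.mul_mem_coeffBall_iff hc).1 (hT ξ) x hx.2
    rwa [mul_sub, map_sub, hξ x hx.1, sub_zero] at h
  let f : ↥(perp L ∩ U) → ↥(perp (Ln n) ∩ U) := fun ξ =>
    ⟨T ξ, (hLn' n _).2 ⟨hTL ξ ((hL _).1 ξ.2.1), hT' ξ⟩, hTU ξ ξ.2.2⟩
  refine Nat.card_eq_of_bijective f ⟨fun ξ η hξη => ?_, fun ξ => ?_⟩
  · have hT_eq : T ξ = T η := congrArg Subtype.val hξη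
    have hmem : c * (ξ.1 - η.1) ∈ LaurentSeries.coeffBall 𝔽 (n + 1) := by
      have h := sub_mem (hT η) (hT ξ)
      rwa [← mul_sub, hT_eq, sub_sub_sub_cancel_left] at h
    have hzero : ∀ x, ω (x * (ξ.1 - η.1)) = 0 := fun x => by
      obtain ⟨l, hl, hxl⟩ := hD x
      have h₁ := (LaurentSeries.mul_mem_coeffBall_iff hc).1 hmem (x - l)
        (LaurentSeries.coeffBall_anti (by omega) hxl)
      rwa [sub_mul, map_sub, mul_sub l, map_sub, (hL _).1 ξ.2.1 l hl, (hL _).1 η.2.1 l hl,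
        sub_zero, sub_zero] at h₁
    have hcz : c * (ξ.1 - η.1) = 0 := by
      ext i
      rw [← LaurentSeries.apply_single_mul hc, hzero]
      rfl
    exact Subtype.ext (sub_eq_zero.1 ((mul_eq_zero.1 hcz).resolve_left hc0))
  · obtain ⟨hξ, hξ'⟩ := (hLn' n _).1 ξ.2.1
    obtain ⟨η, hηU, hη, hclose⟩ := hM ξ ξ.2.2 fun x hx =>
      hξ x ⟨hx.1, LaurentSeries.coeffBall_anti (by omega) hx.2⟩
    have hmem : c * (ξ.1 - η) ∈ LaurentSeries.coeffBall 𝔽 (n + 1) := by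
      rw [LaurentSeries.mul_mem_coeffBall_iff hc]
      intro x hx
      obtain ⟨l, hl, hxl⟩ := hD x
      have hl' : l ∈ LaurentSeries.coeffBall 𝔽 (-n) := by
        rw [← sub_sub_cancel x l]
        exact sub_mem hx (LaurentSeries.coeffBall_anti (by omega) hxl)
      have h₁ : ω ((x - l) * (ξ.1 - η)) = 0 :=
        (LaurentSeries.mul_mem_coeffBall_iff hc).1 hclose _
          (LaurentSeries.coeffBall_anti (by omega) hxl)
      rwa [sub_mul, map_sub, mul_sub l, map_sub, hξ l ⟨hl, hl'⟩, hη l hl, sub_zero,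
        sub_zero] at h₁
    refine ⟨⟨η, (hL _).2 hη, hηU⟩, Subtype.ext (sub_eq_zero.1 ?_)⟩
    change T η - ξ.1 = 0
    refine (mul_eq_zero.1 (HahnSeries.ext (funext fun i => ?_))).resolve_left hc0
    rw [HahnSeries.coeff_zero]
    rcases lt_or_ge n i with hi | hi
    · rw [mul_sub, HahnSeries.coeff_sub, hT' η i hi, hξ' i hi, sub_zero]
    · have h := sub_mem (hT η) hmem i (by omega)
      rwa [← mul_sub, sub_sub_sub_cancel_right] at h
end
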